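/- Let C be a linear code of length n and dimension k over a finite field GF(q) that is near MDS, i.e., the minimum Hamming weight of a nonzero codeword of C is n-k and the minimum Hamming weight of a nonzero codeword of the dual code C^⊥ is k. For each weight w, let A_w denote the number of codewords of C of Hamming weight w. Then for every s ∈ {1, 2, ..., k}: A_{n-k+s} = binom(n, k-s) · Σ_{j=0}^{s-1} (-1)^j · binom(n-k+s, j) · (q^{s-j} - 1) + (-1)^s · binom(k, s) · A_{n-k}. -/

import Mathlib

/-- The Hamming weight of a vector: the number of nonzero coordinates. -/
def wt {ι F : Type} [Fintype ι] [DecidableEq F] [Zero F] (v : ι → F) : ℕ :=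
  (Finset.univ.filter fun i => v i ≠ 0).card

/-- Truncated binomial inversion: the alternating sum detects `z = i` as soon as `z ≤ i + s`. -/
theorem sum_range_neg_one_pow_mul_choose_mul_choose {i s z : ℕ} (hz : z ≤ i + s) :
    ∑ j ∈ Finset.range (s + 1), (-1 : ℤ) ^ j * ((i + j).choose i : ℤ) * (z.choose (i + j) : ℤ)
      = if z = i then 1 else 0 := by
  rcases lt_or_ge z i with h | h
  · rw [if_neg h.ne]
    refine Finset.sum_eq_zero fun j _ => ?_
    rw [Nat.choose_eq_zero_of_lt (by lia : z < i + j)]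
    simp
  · obtain ⟨m, rfl⟩ := Nat.exists_eq_add_of_le h
    have hterm : ∀ j, (-1 : ℤ) ^ j * ((i + j).choose i : ℤ) * ((i + m).choose (i + j) : ℤ)
        = ((i + m).choose i : ℤ) * ((-1 : ℤ) ^ j * (m.choose j : ℤ)) := by
      intro j
      rcases le_or_gt j m with hj | hj
      · have hc := Nat.choose_mul (n := i + m) (k := i + j) (s := i) (by lia)
        rw [Nat.add_sub_cancel_left, Nat.add_sub_cancel_left] at hc
        have hc' : ((i + m).choose (i + j) : ℤ) * ((i + j).choose i : ℤ)
            = ((i + m).choose i : ℤ) * (m.choose j : ℤ) := by exact_mod_cast hc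
        linear_combination (-1 : ℤ) ^ j * hc'
      · rw [Nat.choose_eq_zero_of_lt hj, Nat.choose_eq_zero_of_lt (by lia : i + m < i + j)]
        simp
    have hsub : Finset.range (m + 1) ⊆ Finset.range (s + 1) :=
      Finset.range_subset_range.2 (by lia)
    rw [Finset.sum_congr rfl fun j _ => hterm j, ← Finset.mul_sum,
      ← Finset.sum_subset hsub, Int.alternating_sum_range_choose]
    · by_cases hm : m = 0 <;> simp [hm]
    · intro j _ hj
      rw [Nat.choose_eq_zero_of_lt (by simpa using hj)]
      simp

/-- If no nonzero dual codeword is supported on `T`, then `C` projects onto the coordinates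
in `T`. -/
theorem surjective_restrict_of_dual {ι F : Type} [Fintype ι] [DecidableEq ι] [Field F]
    (C : Submodule F (ι → F)) (T : Finset ι)
    (hT : ∀ v : ι → F, (∀ c ∈ C, ∑ i, v i * c i = 0) → (∀ i ∉ T, v i = 0) → v = 0) :
    Function.Surjective ((LinearMap.funLeft F F ((↑) : T → ι)).comp C.subtype) := by
  rw [← LinearMap.range_eq_top]
  by_contra hne
  obtain ⟨f, hf, hle⟩ := Submodule.exists_le_ker_of_lt_top _ (lt_top_iff_ne_top.2 hne)
  set v : ι → F := fun i => if h : i ∈ T then f (fun j => if ⟨i, h⟩ = j then 1 else 0) else 0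
    with hv
  have hf_apply : ∀ x : ι → F, f (fun j : T => x j) = ∑ i, v i * x i := by
    intro x
    rw [LinearMap.pi_apply_eq_sum_univ f, ← Finset.sum_subset (Finset.subset_univ T),
      ← Finset.sum_coe_sort T]
    · refine Finset.sum_congr rfl fun i _ => ?_
      simp [hv, mul_comm]
    · intro i _ hi
      simp [hv, hi]
  have hv0 : v = 0 := by
    refine hT v (fun c hc => ?_) (fun i hi => by simp [hv, hi])
    rw [← hf_apply]
    exact hle ⟨⟨c, hc⟩, rfl⟩
  refine hf (LinearMap.ext fun x => ?_)
  have hx := hf_apply fun i => if h : i ∈ T then x ⟨i, h⟩ else 0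
  simpa [hv0] using hx

/-- If no nonzero dual codeword is supported on `T`, exactly `q ^ (dim C - |T|) - 1` nonzero
codewords vanish on `T`. -/
theorem card_codewords_vanishing_on {ι F : Type} [Fintype ι] [DecidableEq ι] [Field F] [Fintype F]
    [DecidableEq F] (C : Submodule F (ι → F)) [DecidablePred (· ∈ C)] (T : Finset ι)
    (hT : ∀ v : ι → F, (∀ c ∈ C, ∑ i, v i * c i = 0) → (∀ i ∉ T, v i = 0) → v = 0) :
    ((Finset.univ.filter fun c : ι → F => (c ∈ C ∧ c ≠ 0) ∧ ∀ i ∈ T, c i = 0).card : ℤ)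
      = (Fintype.card F : ℤ) ^ (Module.finrank F C - T.card) - 1 := by
  set g := (LinearMap.funLeft F F ((↑) : T → ι)).comp C.subtype with hg
  have hrank := LinearMap.finrank_range_add_finrank_ker g
  rw [LinearMap.range_eq_top.2 (surjective_restrict_of_dual C T hT), finrank_top,
    Module.finrank_fintype_fun_eq_card, Fintype.card_coe] at hrank
  have hmem : ∀ c : C, c ∈ LinearMap.ker g ↔ ∀ i ∈ T, c.1 i = 0 := by
    intro c
    rw [LinearMap.mem_ker, funext_iff]
    simp [hg, LinearMap.funLeft_apply]
  have hcard : (Finset.univ.filter fun c : ι → F => c ∈ C ∧ ∀ i ∈ T, c i = 0).card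
      = Fintype.card F ^ (Module.finrank F C - T.card) := by
    have e : LinearMap.ker g ≃ {c : ι → F // c ∈ C ∧ ∀ i ∈ T, c i = 0} :=
      { toFun := fun c => ⟨c.1.1, c.1.2, (hmem c.1).1 c.2⟩
        invFun := fun c => ⟨⟨c.1, c.2.1⟩, (hmem _).2 c.2.2⟩
        left_inv := fun _ => rfl
        right_inv := fun _ => rfl }
    rw [← Fintype.card_subtype, ← Nat.card_eq_fintype_card, ← Nat.card_congr e,
      Module.natCard_eq_pow_finrank (K := F), Nat.card_eq_fintype_card]
    congr 1
    lia
  have herase : (Finset.univ.filter fun c : ι → F => (c ∈ C ∧ c ≠ 0) ∧ ∀ i ∈ T, c i = 0)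
      = (Finset.univ.filter fun c : ι → F => c ∈ C ∧ ∀ i ∈ T, c i = 0).erase 0 := by
    ext c
    simp only [Finset.mem_filter, Finset.mem_univ, true_and, Finset.mem_erase]
    tauto
  have hzero : (0 : ι → F) ∈ Finset.univ.filter fun c : ι → F => c ∈ C ∧ ∀ i ∈ T, c i = 0 := by
    simp
  have hadd := Finset.card_erase_add_one hzero
  rw [herase, ← Nat.cast_pow, ← hcard, ← hadd]
  push_cast
  ring

/-- Double counting of pairs `(c, T)` where `T` is a `t`-set of zeros of `c`. -/
theorem sum_choose_card_zeros {ι F : Type} [Fintype ι] [DecidableEq ι] [Zero F] [DecidableEq F]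
    (N : Finset (ι → F)) (t : ℕ) :
    ∑ c ∈ N, (Finset.univ.filter fun i => c i = 0).card.choose t
      = ∑ T ∈ (Finset.univ : Finset ι).powersetCard t,
          (N.filter fun c => ∀ i ∈ T, c i = 0).card := by
  have h := Finset.sum_card_bipartiteAbove_eq_sum_card_bipartiteBelow (s := N)
    (t := (Finset.univ : Finset ι).powersetCard t) (fun c T => ∀ i ∈ T, c i = 0)
  refine Eq.trans (Finset.sum_congr rfl fun c _ => ?_) h
  rw [← Finset.card_powersetCard]
  congr 1
  ext T
  simp only [Finset.mem_powersetCard, Finset.bipartiteAbove, Finset.mem_filter,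
    true_and, Finset.subset_iff, Finset.mem_univ]
  tauto

/-- **Theorem (Dodunekov–Landgev weight distribution formula).**  Let `C` be an
`[n, k]` near MDS code over a finite field `GF(q)`, i.e. the minimum Hamming
weight of a nonzero codeword of `C` is `n-k` and the minimum Hamming weight of
a nonzero codeword of the dual code `C^⊥` is `k`.  Writing `A_w` for the
number of codewords of `C` of Hamming weight `w`, for every `s ∈ {1, …, k}`:
`A_{n-k+s} = C(n, k-s)·Σ_{j=0}^{s-1} (-1)^j·C(n-k+s, j)·(q^{s-j}-1)
             + (-1)^s·C(k, s)·A_{n-k}`. -/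
theorem stmt_18 (n k : ℕ) (F : Type) [Field F] [Fintype F] [DecidableEq F]
    (C : Submodule F (Fin n → F))
    (hdim : Module.finrank F C = k)
    (hCmin : ∀ c ∈ C, c ≠ 0 → n - k ≤ wt c)
    (hCex : ∃ c ∈ C, c ≠ 0 ∧ wt c = n - k)
    (hDmin : ∀ v : Fin n → F, (∀ c ∈ C, ∑ i, v i * c i = 0) → v ≠ 0 → k ≤ wt v)
    (hDex : ∃ v : Fin n → F, (∀ c ∈ C, ∑ i, v i * c i = 0) ∧ v ≠ 0 ∧ wt v = k) :
    ∀ s : ℕ, 1 ≤ s → s ≤ k →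
      (Nat.card {c : Fin n → F // c ∈ C ∧ wt c = n - k + s} : ℤ)
        = (n.choose (k - s) : ℤ) *
            (∑ j ∈ Finset.range s,
              (-1 : ℤ) ^ j * ((n - k + s).choose j : ℤ) *
                ((Fintype.card F : ℤ) ^ (s - j) - 1))
          + (-1 : ℤ) ^ s * (k.choose s : ℤ) *
              (Nat.card {c : Fin n → F // c ∈ C ∧ wt c = n - k} : ℤ) := by
  classical
  intro s hs hsk
  obtain ⟨i, rfl⟩ := Nat.exists_eq_add_of_le' hsk
  have hkn : i + s ≤ n := by
    rw [← hdim]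
    simpa using C.finrank_le
  have hlt : i + s < n := by
    refine lt_of_le_of_ne hkn fun hn => ?_
    obtain ⟨v, hv, hv0, -⟩ := hDex
    have htop : C = ⊤ := Submodule.eq_top_of_finrank_eq (by rw [hdim, hn]; simp)
    refine hv0 (funext fun a => ?_)
    simpa [Pi.single_apply] using hv (Pi.single a 1) (htop ▸ Submodule.mem_top)
  set N : Finset (Fin n → F) := Finset.univ.filter fun c => c ∈ C ∧ c ≠ 0 with hN
  set z : (Fin n → F) → ℕ := fun c => (Finset.univ.filter fun a => c a = 0).card with hz
  have hzwt : ∀ c, z c + wt c = n := by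
    intro c
    simpa [hz, wt] using
      Finset.card_filter_add_card_filter_not (s := (Finset.univ : Finset (Fin n))) (c · = 0)
  have hzle : ∀ c ∈ N, z c ≤ i + s := by
    intro c hc
    have hc' := (Finset.mem_filter.1 hc).2
    have := hCmin c hc'.1 hc'.2
    have := hzwt c
    lia
  have hcount : ∀ w m : ℕ, w + m = n → 0 < w →
      (Nat.card {c : Fin n → F // c ∈ C ∧ wt c = w} : ℤ) = ∑ c ∈ N, if z c = m then 1 else 0 := by
    intro w m hwm hw
    rw [Finset.sum_boole, Nat.card_eq_fintype_card, Fintype.card_subtype]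
    congr 2
    ext c
    have := hzwt c
    simp only [hN, Finset.mem_filter, Finset.mem_univ, true_and]
    constructor
    · rintro ⟨hc, hcw⟩
      refine ⟨⟨hc, ?_⟩, by lia⟩
      rintro rfl
      simp [wt] at hcw
      lia
    · rintro ⟨⟨hc, -⟩, hcm⟩
      exact ⟨hc, by lia⟩
  have hmoment : ∀ t < i + s, ∑ c ∈ N, ((z c).choose t : ℤ)
      = (n.choose t : ℤ) * ((Fintype.card F : ℤ) ^ (i + s - t) - 1) := by
    intro t ht
    rw [← Nat.cast_sum, sum_choose_card_zeros, Nat.cast_sum]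
    have hT : ∀ T ∈ (Finset.univ : Finset (Fin n)).powersetCard t, ∀ v : Fin n → F,
        (∀ c ∈ C, ∑ a, v a * c a = 0) → (∀ a ∉ T, v a = 0) → v = 0 := by
      intro T hT v hv hvT
      by_contra hv0
      have hTt := (Finset.mem_powersetCard.1 hT).2
      have hle : wt v ≤ T.card := Finset.card_le_card fun a ha => by
        by_contra haT
        exact (Finset.mem_filter.1 ha).2 (hvT a haT)
      have := hDmin v hv hv0
      lia
    refine (Finset.sum_congr rfl fun T hTm =>
      Eq.trans ?_ (card_codewords_vanishing_on C T (hT T hTm))).trans ?_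
    · rw [hN, Finset.filter_filter]
    · rw [Finset.sum_congr rfl fun T hTm => by rw [hdim, (Finset.mem_powersetCard.1 hTm).2]]
      simp [mul_sub]
  have htop : ∑ c ∈ N, ((z c).choose (i + s) : ℤ) = ∑ c ∈ N, if z c = i + s then 1 else 0 := by
    refine Finset.sum_congr rfl fun c hc => ?_
    split_ifs with h
    · simp [h]
    · rw [Nat.choose_eq_zero_of_lt (lt_of_le_of_ne (hzle c hc) h), Nat.cast_zero]
  rw [hcount (n - (i + s) + s) i (by lia) (by lia), hcount (n - (i + s)) (i + s) (by lia) (by lia),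
    Finset.sum_congr rfl fun c hc =>
      (sum_range_neg_one_pow_mul_choose_mul_choose (hzle c hc)).symm,
    Finset.sum_comm, Finset.sum_range_succ, ← Finset.mul_sum, htop, Nat.choose_symm_add,
    Nat.add_sub_cancel]
  congr 1
  rw [Finset.mul_sum]
  refine Finset.sum_congr rfl fun j hj => ?_
  have hjs := Finset.mem_range.1 hj
  rw [← Finset.mul_sum, hmoment (i + j) (by lia), Nat.add_sub_add_left]
  have hc := Nat.choose_mul (n := n) (k := i + j) (s := i) (by lia)
  rw [Nat.add_sub_cancel_left, show n - i = n - (i + s) + s by lia] at hc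
  have hc' : (n.choose (i + j) : ℤ) * ((i + j).choose i : ℤ)
      = (n.choose i : ℤ) * ((n - (i + s) + s).choose j : ℤ) := by exact_mod_cast hc
  linear_combination (-1 : ℤ) ^ j * ((Fintype.card F : ℤ) ^ (s - j) - 1) * hc'
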